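/- arXiv:1301.4285 — 4 statements merged into one kernel-verified Lean document; each statement's English description precedes it below -/
import Mathlib

section
/- Let V be a finite-dimensional real vector space and let C : V × V × V → ℝ be trilinear with C(u,v,w) = C(v,u,w) and C(u,v,w) + C(v,w,u) + C(w,u,v) = 0 for all u,v,w ∈ V. Then there exists a trilinear map B : V × V × V → ℝ with B(u,v,w) = −B(u,w,v) for all u,v,w ∈ V such that C(u,v,w) = (1/2)(B(u,v,w) + B(v,u,w)) for all u,v,w ∈ V. -/
/-- If `V` is finite dimensional and `C : V × V × V → ℝ` is a trilinear map which is
symmetric in its first two arguments and whose cyclic sums vanish (a gyroscopic tensor),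
then there is a trilinear map `B` with `B(u,v,w) = -B(u,w,v)` such that
`C(u,v,w) = (1/2)(B(u,v,w) + B(v,u,w))`; in other words, `𝒞(V) ⊆ ψ(ℬ(V))`. -/
theorem stmt_3 (V : Type*) [AddCommGroup V] [Module ℝ V] [FiniteDimensional ℝ V]
    (C : V →ₗ[ℝ] V →ₗ[ℝ] V →ₗ[ℝ] ℝ)
    (hC1 : ∀ u v w : V, C u v w = C v u w)
    (hC2 : ∀ u v w : V, C u v w + C v w u + C w u v = 0) :
    ∃ B : V →ₗ[ℝ] V →ₗ[ℝ] V →ₗ[ℝ] ℝ,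
      (∀ u v w : V, B u v w = - B u w v) ∧
      (∀ u v w : V, C u v w = (1 / 2) * (B u v w + B v u w)) := by
  let F : (V →ₗ[ℝ] V →ₗ[ℝ] ℝ) →ₗ[ℝ] V →ₗ[ℝ] V →ₗ[ℝ] ℝ := LinearMap.lflip.toLinearMap
  refine ⟨(2 / 3 : ℝ) • C + (-(2 / 3) : ℝ) • F ∘ₗ C, fun u v w => ?_, fun u v w => ?_⟩
  · simp [F]
  · simp [F]
    linarith [hC1 u v w, hC1 u w v, hC2 u v w]
end

section
/- Let V be a finite-dimensional real vector space with a direct sum decomposition V = Ṽ ⊕ V̂, and let T : V × V × V → ℝ be a trilinear map satisfying T(u,v,w) = T(v,u,w) for all u,v,w ∈ V. Then the following are equivalent: (a) there exists a trilinear map C : V × V × V → ℝ satisfying C(u,v,w) = C(v,u,w) and C(u,v,w) + C(v,w,u) + C(w,u,v) = 0 for all u,v,w ∈ V, and C(v₁,v₂,ṽ) = T(v₁,v₂,ṽ) for all v₁,v₂ ∈ V and ṽ ∈ Ṽ; (b) T(ṽ₁,ṽ₂,ṽ₃) + T(ṽ₂,ṽ₃,ṽ₁) + T(ṽ₃,ṽ₁,ṽ₂)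 = 0 for all ṽ₁,ṽ₂,ṽ₃ ∈ Ṽ. -/
/-- A trilinear map agreeing with `T` when its third argument is fixed by `P`, which is a
gyroscopic tensor when `T` is symmetric in its first two arguments and its cyclic sums vanish
on the range of `P`. -/
noncomputable def gyroscopicExtension {V : Type*} [AddCommGroup V] [Module ℝ V]
    (P : V →ₗ[ℝ] V) (T : V →ₗ[ℝ] V →ₗ[ℝ] V →ₗ[ℝ] ℝ) : V →ₗ[ℝ] V →ₗ[ℝ] V →ₗ[ℝ] ℝ :=
  LinearMap.mk₂ ℝ
    (fun u v => (T u v).comp P +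
      (-(T (P v)).flip (P u) - (T (P u)).flip (P v)
        - (1 / 2 : ℝ) • (T (v - P v)).flip (P u)
        - (1 / 2 : ℝ) • (T (u - P u)).flip (P v)).comp (LinearMap.id - P))
    (by intros; ext; simp; ring)
    (by intros; ext; simp; ring)
    (by intros; ext; simp; ring)
    (by intros; ext; simp; ring)

theorem gyroscopicExtension_apply {V : Type*} [AddCommGroup V] [Module ℝ V]
    (P : V →ₗ[ℝ] V) (T : V →ₗ[ℝ] V →ₗ[ℝ] V →ₗ[ℝ] ℝ) (u v w : V) :
    gyroscopicExtension P T u v w = T u v (P w) - T (P v) (w - P w) (P u)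
      - T (P u) (w - P w) (P v) - 1 / 2 * T (v - P v) (w - P w) (P u)
      - 1 / 2 * T (u - P u) (w - P w) (P v) := by
  simp [gyroscopicExtension]
  ring


/-- Let `V = Ṽ ⊕ V̂` be a direct sum decomposition of a finite-dimensional real vector
space and let `T : V × V × V → ℝ` be trilinear and symmetric in its first two
arguments. Then there exists a gyroscopic tensor `C` (trilinear, symmetric in the
first two arguments, vanishing cyclic sums) agreeing with `T` whenever the third
argument lies in `Ṽ`, iff the cyclic sums of `T` vanish on `Ṽ × Ṽ × Ṽ`. -/
theorem stmt_8 (V : Type*) [AddCommGroup V] [Module ℝ V] [FiniteDimensional ℝ V]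
    (Wtilde What : Submodule ℝ V) (hcompl : IsCompl Wtilde What)
    (T : V →ₗ[ℝ] V →ₗ[ℝ] V →ₗ[ℝ] ℝ)
    (hT : ∀ u v w : V, T u v w = T v u w) :
    (∃ C : V →ₗ[ℝ] V →ₗ[ℝ] V →ₗ[ℝ] ℝ,
        (∀ u v w : V, C u v w = C v u w) ∧
        (∀ u v w : V, C u v w + C v w u + C w u v = 0) ∧
        (∀ v₁ v₂ : V, ∀ vt ∈ Wtilde, C v₁ v₂ vt = T v₁ v₂ vt)) ↔
      (∀ vt₁ ∈ Wtilde, ∀ vt₂ ∈ Wtilde, ∀ vt₃ ∈ Wtilde,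
        T vt₁ vt₂ vt₃ + T vt₂ vt₃ vt₁ + T vt₃ vt₁ vt₂ = 0) := by
  constructor
  · rintro ⟨C, -, hcyc, hCT⟩ a ha b hb c hc
    rw [← hCT a b c hc, ← hCT b c a ha, ← hCT c a b hb]
    exact hcyc a b c
  · intro h
    obtain ⟨P, hPmem, hPid⟩ : ∃ P : V →ₗ[ℝ] V,
        (∀ x, P x ∈ Wtilde) ∧ ∀ x ∈ Wtilde, P x = x :=
      ⟨Wtilde.projection What hcompl, Submodule.projection_apply_mem hcompl,
        fun _ => Submodule.projection_apply_of_mem_left hcompl⟩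
    refine ⟨gyroscopicExtension P T, fun u v w => ?_, fun u v w => ?_, fun u v w hw => ?_⟩
    · simp only [gyroscopicExtension_apply, hT u v]
      ring
    · have hP := h (P u) (hPmem u) (P v) (hPmem v) (P w) (hPmem w)
      simp only [gyroscopicExtension_apply, map_sub, LinearMap.sub_apply]
      linarith [hT u v (P w), hT v w (P u), hT w u (P v), hT (P u) v (P w), hT (P u) w (P v),
        hT (P v) u (P w), hT (P v) w (P u), hT (P w) u (P v), hT (P w) v (P u),
        hT (P u) (P v) (P w), hT (P v) (P w) (P u), hT (P w) (P u) (P v)]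
    · simp [gyroscopicExtension_apply, hPid w hw]
end

section
/- Fix natural numbers m ≤ n and set d = n − m. Let T : (Fin n)³ → ℝ satisfy T(i,j,k) = T(j,i,k) for all i,j,k, and T(α,β,γ) + T(β,γ,α) + T(γ,α,β) = 0 whenever all of α,β,γ < d. Define C : (Fin n)³ → ℝ by: C(i,j,α) = T(i,j,α) whenever α < d; C(α,β,a) = −T(β,a,α) − T(a,α,β) whenever α,β < d and a ≥ d; C(α,a,b) = C(a,α,b) = C(b,α,a) = C(α,b,a) = −(1/2)T(a,b,α) whenever α < d and a,b ≥ d; and C(a,b,c) = 0 whenever a,b,c ≥ d. Then C satisfies C(i,j,k) = C(j,i,k) for all i,j,k, C(i,j,k) + C(j,k,i) + C(k,i,j) = 0 for all i,j,k, and C(i,j,α) = T(i,j,α) for all i,j and all α < d. -/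
/-- Coordinate construction of the gyroscopic tensor `C` from the tensor `T`
(Lemma on partial gyroscopic extension, in coordinates). Indices `< d` are the
unactuated ones and indices `≥ d` (with `d = n − m`) the actuated ones. If `T` is
symmetric in its first two indices and its cyclic sums over unactuated triples vanish,
and `C` is defined piecewise from `T` as indicated, then `C` is symmetric in its first
two indices, all its cyclic sums vanish, and `C` agrees with `T` whenever the third
index is unactuated. -/
theorem stmt_9 (n m : ℕ) (hmn : m ≤ n) (d : ℕ) (hd : d = n - m)
    (T C : Fin n → Fin n → Fin n → ℝ)
    (hTsym : ∀ i j k : Fin n, T i j k = T j i k)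
    (hTcyc : ∀ α β γ : Fin n, (α : ℕ) < d → (β : ℕ) < d → (γ : ℕ) < d →
      T α β γ + T β γ α + T γ α β = 0)
    (hC1 : ∀ i j α : Fin n, (α : ℕ) < d → C i j α = T i j α)
    (hC2 : ∀ α β a : Fin n, (α : ℕ) < d → (β : ℕ) < d → d ≤ (a : ℕ) →
      C α β a = - T β a α - T a α β)
    (hC3 : ∀ α a b : Fin n, (α : ℕ) < d → d ≤ (a : ℕ) → d ≤ (b : ℕ) →
      C α a b = -(1 / 2) * T a b α ∧ C a α b = -(1 / 2) * T a b α ∧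
        C b α a = -(1 / 2) * T a b α ∧ C α b a = -(1 / 2) * T a b α)
    (hC4 : ∀ a b c : Fin n, d ≤ (a : ℕ) → d ≤ (b : ℕ) → d ≤ (c : ℕ) → C a b c = 0) :
    (∀ i j k : Fin n, C i j k = C j i k) ∧
    (∀ i j k : Fin n, C i j k + C j k i + C k i j = 0) ∧
    (∀ i j α : Fin n, (α : ℕ) < d → C i j α = T i j α) := by
  refine ⟨fun i j k => ?_, fun i j k => ?_, hC1⟩
  · rcases lt_or_ge (k : ℕ) d with hk | hk
    · rw [hC1 i j k hk, hC1 j i k hk, hTsym]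
    · rcases lt_or_ge (i : ℕ) d with hi | hi <;> rcases lt_or_ge (j : ℕ) d with hj | hj
      · rw [hC2 i j k hi hj hk, hC2 j i k hj hi hk, hTsym j k i, hTsym k i j]
        ring
      · rw [(hC3 i j k hi hj hk).1, (hC3 i j k hi hj hk).2.1]
      · rw [(hC3 j i k hj hi hk).1, (hC3 j i k hj hi hk).2.1]
      · rw [hC4 i j k hi hj hk, hC4 j i k hj hi hk]
  · rcases lt_or_ge (i : ℕ) d with hi | hi <;> rcases lt_or_ge (j : ℕ) d with hj | hj <;>
      rcases lt_or_ge (k : ℕ) d with hk | hk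
    · rw [hC1 i j k hk, hC1 j k i hi, hC1 k i j hj, hTcyc i j k hi hj hk]
    · rw [hC2 i j k hi hj hk, hC1 j k i hi, hC1 k i j hj]
      ring
    · rw [hC2 k i j hk hi hj, hC1 i j k hk, hC1 j k i hi]
      ring
    · rw [(hC3 i j k hi hj hk).1, (hC3 i j k hi hj hk).2.2.1, hC1 j k i hi]
      ring
    · rw [hC2 j k i hj hk hi, hC1 i j k hk, hC1 k i j hj]
      ring
    · rw [(hC3 j k i hj hk hi).1, (hC3 j k i hj hk hi).2.2.1, hC1 k i j hj]
      ring
    · rw [(hC3 k i j hk hi hj).1, (hC3 k i j hk hi hj).2.2.1, hC1 i j k hk]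
      ring
    · rw [hC4 i j k hi hj hk, hC4 j k i hj hk hi, hC4 k i j hk hi hj]
      ring
end

section
/- Fix n, m ∈ ℕ with m ≤ n. Let M be a constant real symmetric positive definite n×n matrix, P a constant real symmetric n×n matrix, G a constant real n×m matrix of rank m, and G^⊥ a constant real (n−m)×n matrix of rank n−m with G^⊥G = 0. Define the 2n×2n matrix A = [[0, M⁻¹],[−P, 0]] and the 2n×m matrix B = [[0],[G]]. Then the following are equivalent: (i) the pair (A,B) is controllable, i.e., the 2n × (2n·m) block matrix [B, AB, A²B, …, A^{2n−1}B] has rank 2n; (ii) there exist constant real symmetric positive definite n×n matrices M̂ and Ŝ and a constant real symmetric positive definite m×m matrix Kᵥ such that G^⊥(P − M̂ M⁻¹ Ŝ) = 0 and every complex eigenvalue of the 2n×2n closed-loop matrix A_cl = [[0, M⁻¹],[−M̂ M⁻¹ Ŝ, −G Kᵥ Gᵀ M̂⁻¹]] has strictly negative real part. -/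
open Matrix

/-- The controllability matrix `[B, AB, A²B, …, A^{2n−1}B]` of the pair `(A, B)` for a
`2n`-dimensional linear system, recorded as a `2n × (2n·m)` matrix. -/
noncomputable def ctrbMatrix (n m : ℕ)
    (A : Matrix (Fin n ⊕ Fin n) (Fin n ⊕ Fin n) ℝ)
    (B : Matrix (Fin n ⊕ Fin n) (Fin m) ℝ) :
    Matrix (Fin n ⊕ Fin n) (Fin (2 * n) × Fin m) ℝ :=
  Matrix.of fun i jk => (A ^ (jk.1 : ℕ) * B) i jk.2

/-- The pair `(X, G)` is controllable: only `0` annihilates every `X ^ k * G` from the left. -/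
def IsCtrbPair {n m : ℕ} (X : Matrix (Fin n) (Fin n) ℝ) (G : Matrix (Fin n) (Fin m) ℝ) : Prop :=
  ∀ b : Fin n → ℝ, (∀ k : ℕ, b ᵥ* (X ^ k * G) = 0) → b = 0

theorem rank_eq_card_iff_vecMul {ι κ : Type*} [Fintype ι] [Fintype κ] (C : Matrix ι κ ℝ) :
    C.rank = Fintype.card ι ↔ ∀ w : ι → ℝ, w ᵥ* C = 0 → w = 0 := by
  have h := LinearMap.finrank_range_add_finrank_ker Cᵀ.mulVecLin
  rw [Module.finrank_pi] at h
  rw [← rank_transpose, Matrix.rank]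
  have h2 : Module.finrank ℝ (LinearMap.range Cᵀ.mulVecLin) = Fintype.card ι ↔
      Module.finrank ℝ (LinearMap.ker Cᵀ.mulVecLin) = 0 := by omega
  rw [h2, Submodule.finrank_eq_zero, LinearMap.ker_eq_bot']
  simp

theorem vecMul_pow_mul_eq_zero {ι κ : Type*} [Fintype ι] [DecidableEq ι]
    (A : Matrix ι ι ℝ) (B : Matrix ι κ ℝ) (w : ι → ℝ)
    (h : ∀ k < Fintype.card ι, w ᵥ* (A ^ k * B) = 0) (k : ℕ) : w ᵥ* (A ^ k * B) = 0 := by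
  rcases isEmpty_or_nonempty ι with hι | hι
  · ext j
    simp [vecMul, dotProduct]
  rw [pow_eq_aeval_mod_charpoly]
  have hdeg : (Polynomial.X ^ k %ₘ A.charpoly).natDegree < Fintype.card ι := by
    rw [← A.charpoly_natDegree_eq_dim]
    refine Polynomial.natDegree_modByMonic_lt _ A.charpoly_monic fun h1 => ?_
    have := A.charpoly_natDegree_eq_dim
    rw [h1, Polynomial.natDegree_one] at this
    exact Fintype.card_ne_zero this.symm
  rw [Polynomial.aeval_eq_sum_range' hdeg, Matrix.sum_mul, vecMul_sum]
  refine Finset.sum_eq_zero fun i hi => ?_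
  rw [Matrix.smul_mul, vecMul_smul, h i (Finset.mem_range.1 hi), smul_zero]

theorem secondOrder_pow_even {n m : ℕ} (L Q : Matrix (Fin n) (Fin n) ℝ)
    (G : Matrix (Fin n) (Fin m) ℝ) (k : ℕ) :
    (fromBlocks 0 L Q 0 : Matrix (Fin n ⊕ Fin n) (Fin n ⊕ Fin n) ℝ) ^ (2 * k) *
        (fromRows 0 G : Matrix (Fin n ⊕ Fin n) (Fin m) ℝ) =
      fromRows 0 ((Q * L) ^ k * G) := by
  induction k with
  | zero => simp
  | succ k ih =>
    rw [show 2 * (k + 1) = 2 * k + 1 + 1 by ring, pow_succ', pow_succ', Matrix.mul_assoc,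
      Matrix.mul_assoc, ih, fromBlocks_mul_fromRows, fromBlocks_mul_fromRows, pow_succ']
    simp [Matrix.mul_assoc]

theorem secondOrder_pow_odd {n m : ℕ} (L Q : Matrix (Fin n) (Fin n) ℝ)
    (G : Matrix (Fin n) (Fin m) ℝ) (k : ℕ) :
    (fromBlocks 0 L Q 0 : Matrix (Fin n ⊕ Fin n) (Fin n ⊕ Fin n) ℝ) ^ (2 * k + 1) *
        (fromRows 0 G : Matrix (Fin n ⊕ Fin n) (Fin m) ℝ) =
      fromRows (L * ((Q * L) ^ k * G)) 0 := by
  rw [pow_succ', Matrix.mul_assoc, secondOrder_pow_even, fromBlocks_mul_fromRows]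
  simp

theorem rank_ctrbMatrix_iff {n m : ℕ} (L Q : Matrix (Fin n) (Fin n) ℝ)
    (G : Matrix (Fin n) (Fin m) ℝ) (hL : IsUnit L) :
    (ctrbMatrix n m (fromBlocks 0 L Q 0) (fromRows 0 G)).rank = 2 * n ↔
      IsCtrbPair (Q * L) G := by
  have hcard : Fintype.card (Fin n ⊕ Fin n) = 2 * n := by simp [two_mul]
  have key : ∀ w : Fin n ⊕ Fin n → ℝ,
      w ᵥ* ctrbMatrix n m (fromBlocks 0 L Q 0) (fromRows 0 G) = 0 ↔
      ∀ k, w ᵥ* ((fromBlocks 0 L Q 0 : Matrix (Fin n ⊕ Fin n) (Fin n ⊕ Fin n) ℝ) ^ k *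
        (fromRows 0 G : Matrix (Fin n ⊕ Fin n) (Fin m) ℝ)) = 0 := by
    intro w
    constructor
    · intro h
      refine vecMul_pow_mul_eq_zero _ _ _ fun k hk => ?_
      ext j
      exact congrFun h (⟨k, hcard ▸ hk⟩, j)
    · intro h
      ext ⟨k, j⟩
      exact congrFun (h k) j
  have hrank := rank_eq_card_iff_vecMul (ctrbMatrix n m (fromBlocks 0 L Q 0) (fromRows 0 G))
  rw [hcard] at hrank
  rw [hrank]
  constructor
  · intro h b hb
    have := h (Sum.elim 0 b) ((key _).2 fun k => ?_)
    · ext i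
      exact congrFun this (Sum.inr i)
    · rcases Nat.even_or_odd' k with ⟨j, rfl | rfl⟩
      · rw [secondOrder_pow_even, sumElim_vecMul_fromRows]
        simp [hb]
      · rw [secondOrder_pow_odd, sumElim_vecMul_fromRows]
        simp
  · intro h w hw
    rw [key] at hw
    obtain ⟨a, b, rfl⟩ : ∃ a b, w = Sum.elim a b :=
      ⟨w ∘ Sum.inl, w ∘ Sum.inr, (Sum.elim_comp_inl_inr w).symm⟩
    have hb : b = 0 := h b fun k => by
      have := hw (2 * k)
      rwa [secondOrder_pow_even, sumElim_vecMul_fromRows, vecMul_zero, zero_add] at this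
    have ha : a ᵥ* L = 0 := h _ fun k => by
      have := hw (2 * k + 1)
      rwa [secondOrder_pow_odd, sumElim_vecMul_fromRows, vecMul_zero, add_zero,
        ← vecMul_vecMul] at this
    have ha' : a = 0 := vecMul_injective_of_isUnit hL (by simpa using ha)
    ext (i | i) <;> simp [ha', hb]

theorem re_vecMul_map_ofReal {n m : ℕ} (C : Matrix (Fin n) (Fin m) ℝ) (z : Fin n → ℂ) :
    (fun j => ((z ᵥ* C.map Complex.ofRealHom) j).re) = (fun i => (z i).re) ᵥ* C := by
  ext j
  simp [vecMul, dotProduct]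

theorem im_vecMul_map_ofReal {n m : ℕ} (C : Matrix (Fin n) (Fin m) ℝ) (z : Fin n → ℂ) :
    (fun j => ((z ᵥ* C.map Complex.ofRealHom) j).im) = (fun i => (z i).im) ᵥ* C := by
  ext j
  simp [vecMul, dotProduct]

/-- Complexified form of the controllability of a pair. -/
theorem IsCtrbPair.complex {n m : ℕ} {X : Matrix (Fin n) (Fin n) ℝ} {G : Matrix (Fin n) (Fin m) ℝ}
    (h : IsCtrbPair X G) (z : Fin n → ℂ)
    (hz : ∀ k : ℕ, z ᵥ* (X ^ k * G).map Complex.ofRealHom = 0) : z = 0 := by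
  have hre := h (fun i => (z i).re) fun k => by
    rw [← re_vecMul_map_ofReal, hz]; rfl
  have him := h (fun i => (z i).im) fun k => by
    rw [← im_vecMul_map_ofReal, hz]; rfl
  ext i
  exact Complex.ext (congrFun hre i) (congrFun him i)

theorem map_pow_mul {n m : ℕ} (X : Matrix (Fin n) (Fin n) ℝ) (G : Matrix (Fin n) (Fin m) ℝ)
    (k : ℕ) : (X ^ k * G).map Complex.ofRealHom =
      (X.map Complex.ofRealHom) ^ k * G.map Complex.ofRealHom := by
  rw [Matrix.map_mul]
  congr 1
  exact map_pow Complex.ofRealHom.mapMatrix X k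

/-- The Hautus eigenvector test for controllability of a pair. -/
theorem isCtrbPair_iff_hautus {n m : ℕ} (X : Matrix (Fin n) (Fin n) ℝ)
    (G : Matrix (Fin n) (Fin m) ℝ) :
    IsCtrbPair X G ↔ ∀ (μ : ℂ) (z : Fin n → ℂ), z ᵥ* X.map Complex.ofRealHom = μ • z →
      z ᵥ* G.map Complex.ofRealHom = 0 → z = 0 := by
  constructor
  · intro h μ z hX hG
    refine h.complex z fun k => ?_
    have hk : z ᵥ* (X.map Complex.ofRealHom) ^ k = μ ^ k • z := by
      induction k with
      | zero => simp
      | succ k ih => rw [pow_succ, ← vecMul_vecMul, ih, smul_vecMul, hX, smul_smul, pow_succ]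
    rw [map_pow_mul, ← vecMul_vecMul, hk, smul_vecMul, hG, smul_zero]
  · intro h b hb
    by_contra hb0
    let U : Submodule ℂ (Fin n → ℂ) :=
      ⨅ k : ℕ, LinearMap.ker ((X ^ k * G).map Complex.ofRealHom).vecMulLinear
    have hmem : ∀ z, z ∈ U ↔ ∀ k : ℕ, z ᵥ* (X ^ k * G).map Complex.ofRealHom = 0 := by
      intro z
      simp [U, Submodule.mem_iInf]
    have hinv : ∀ z ∈ U, (X.map Complex.ofRealHom).vecMulLinear z ∈ U := by
      intro z hz
      rw [hmem] at hz ⊢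
      intro k
      have := hz (k + 1)
      rwa [map_pow_mul, pow_succ', Matrix.mul_assoc, ← vecMul_vecMul, ← map_pow_mul] at this
    have hbU : (fun i => (b i : ℂ)) ∈ U := by
      rw [hmem]
      intro k
      ext j
      have := congrArg (fun r : ℝ => (r : ℂ)) (congrFun (hb k) j)
      simpa [vecMul, dotProduct] using this
    have : Nontrivial U := by
      refine ⟨⟨⟨_, hbU⟩, 0, fun h0 => hb0 ?_⟩⟩
      ext i
      have := congrFun (congrArg Subtype.val h0) i
      simpa using this
    obtain ⟨μ, hμ⟩ := Module.End.exists_eigenvalue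
      ((X.map Complex.ofRealHom).vecMulLinear.restrict hinv)
    obtain ⟨z, hz⟩ := hμ.exists_hasEigenvector
    refine hz.2 (Subtype.ext (h μ z ?_ ?_))
    · exact congrArg Subtype.val hz.apply_eq_smul
    · have := (hmem z).1 z.2 0
      simpa using this

theorem exists_eq_mul_of_annihilator {n m : ℕ} (hmn : m ≤ n)
    {G : Matrix (Fin n) (Fin m) ℝ} (hG : G.rank = m)
    {Gperp : Matrix (Fin (n - m)) (Fin n) ℝ} (hGperp : Gperp.rank = n - m)
    (hGperpG : Gperp * G = 0) {W : Matrix (Fin n) (Fin n) ℝ} (hW : Gperp * W = 0) :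
    ∃ F : Matrix (Fin m) (Fin n) ℝ, W = G * F := by
  have hle : LinearMap.range G.mulVecLin ≤ LinearMap.ker Gperp.mulVecLin := by
    rintro _ ⟨u, rfl⟩
    simp [hGperpG]
  have hrk := LinearMap.finrank_range_add_finrank_ker Gperp.mulVecLin
  have heq : LinearMap.range G.mulVecLin = LinearMap.ker Gperp.mulVecLin := by
    refine Submodule.eq_of_le_of_finrank_eq hle ?_
    rw [Module.finrank_pi, Fintype.card_fin] at hrk
    unfold Matrix.rank at hG hGperp
    omega
  have hcol : ∀ j, ∃ u, G *ᵥ u = W.col j := by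
    intro j
    have : W.col j ∈ LinearMap.range G.mulVecLin := by
      rw [heq, LinearMap.mem_ker]
      ext i
      exact congrFun (congrFun hW i) j
    simpa using this
  choose u hu using hcol
  refine ⟨Matrix.of fun i j => u j i, ?_⟩
  ext i j
  exact (congrFun (hu j) i).symm

/-- A convex cone in a finite-dimensional space whose polar is trivial is the whole space. -/
theorem Convex.eq_univ_of_polar_trivial {V : Type*} [NormedAddCommGroup V] [NormedSpace ℝ V]
    [FiniteDimensional ℝ V] {K : Set V} (hconv : Convex ℝ K) (h0 : (0 : V) ∈ K)
    (hsmul : ∀ c : ℝ, 0 < c → ∀ x ∈ K, c • x ∈ K)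
    (hdual : ∀ f : V →ₗ[ℝ] ℝ, (∀ x ∈ K, f x ≤ 0) → f = 0) : K = Set.univ := by
  have hcl : closure K = Set.univ := by
    by_contra hne
    obtain ⟨x, hx⟩ := (Set.ne_univ_iff_exists_notMem _).1 hne
    obtain ⟨f, u, hfu, hux⟩ := geometric_hahn_banach_closed_point hconv.closure isClosed_closure hx
    have hu : 0 < u := by simpa using hfu 0 (subset_closure h0)
    have hf : (f : V →ₗ[ℝ] ℝ) = 0 := hdual _ fun a ha => by
      by_contra! hpos
      have hpos' : 0 < f a := hpos
      have := hfu _ (subset_closure (hsmul (u / f a) (div_pos hu hpos') a ha))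
      rw [map_smul, smul_eq_mul, div_mul_cancel₀ _ hpos'.ne'] at this
      exact lt_irrefl _ this
    have hfx : f x = 0 := LinearMap.congr_fun hf x
    linarith
  have hspan : affineSpan ℝ K = ⊤ := by
    have hclosed : IsClosed (affineSpan ℝ K : Set V) :=
      AffineSubspace.closed_of_finiteDimensional _
    have := closure_minimal (subset_affineSpan ℝ K) hclosed
    rw [hcl] at this
    exact SetLike.coe_injective (Set.univ_subset_iff.1 this)
  have hint := hconv.interior_closure_eq_interior_of_nonempty_interior
    (hconv.interior_nonempty_iff_affineSpan_eq_top.2 hspan)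
  rw [hcl, interior_univ] at hint
  exact Set.univ_subset_iff.1 (hint ▸ interior_subset)

theorem bilin_add_swap_eq_zero_of_nonpos {E : Type*} [AddCommGroup E] [Module ℝ E]
    (b : E →ₗ[ℝ] E →ₗ[ℝ] ℝ) (h : ∀ x, b x x ≤ 0) {g : E} (hg : b g g = 0) (y : E) :
    b g y + b y g = 0 := by
  by_contra hne
  have := h (y + ((1 - b y y) / (b g y + b y g)) • g)
  simp only [map_add, LinearMap.add_apply, map_smul, LinearMap.smul_apply, smul_eq_mul, hg] at this
  have h2 : (1 - b y y) / (b g y + b y g) * (b g y + b y g) = 1 - b y y := div_mul_cancel₀ _ hne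
  linarith

theorem bilin_pow_apply_eq_zero {E : Type*} [AddCommGroup E] [Module ℝ E]
    (b : E →ₗ[ℝ] E →ₗ[ℝ] ℝ) (T : Module.End ℝ E) (h : ∀ x, b x x ≤ 0) (hT : ∀ x, b (T x) x ≤ 0)
    {g : E} (hg : ∀ y, b g y = 0) (k : ℕ) (y : E) : b ((T ^ k) g) y = 0 := by
  induction k generalizing y with
  | zero => simpa using hg y
  | succ k ih =>
    have hswap : ∀ y, b y ((T ^ k) g) = 0 := fun y => by
      have := bilin_add_swap_eq_zero_of_nonpos b h (ih _) y
      rwa [ih, zero_add] at this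
    have := bilin_add_swap_eq_zero_of_nonpos (b ∘ₗ T) hT (hswap _) y
    rw [LinearMap.comp_apply, LinearMap.comp_apply, hswap, add_zero] at this
    rwa [pow_succ', Module.End.mul_apply]

/-- If `(X, G)` is controllable, every matrix is of the form `X * S + Z + G * Y` with `S`, `Z`
positive semidefinite. -/
theorem IsCtrbPair.exists_posSemidef_decomposition {n m : ℕ} {X : Matrix (Fin n) (Fin n) ℝ}
    {G : Matrix (Fin n) (Fin m) ℝ} (h : IsCtrbPair X G) (R : Matrix (Fin n) (Fin n) ℝ) :
    ∃ (S Z : Matrix (Fin n) (Fin n) ℝ) (Y : Matrix (Fin m) (Fin n) ℝ),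
      S.PosSemidef ∧ Z.PosSemidef ∧ R = X * S + Z + G * Y := by
  let _ : NormedAddCommGroup (Matrix (Fin n) (Fin n) ℝ) := Matrix.normedAddCommGroup
  let _ : NormedSpace ℝ (Matrix (Fin n) (Fin n) ℝ) := Matrix.normedSpace
  let K : Set (Matrix (Fin n) (Fin n) ℝ) := {R | ∃ (S Z : Matrix (Fin n) (Fin n) ℝ)
    (Y : Matrix (Fin m) (Fin n) ℝ), S.PosSemidef ∧ Z.PosSemidef ∧ R = X * S + Z + G * Y}
  suffices hK : K = Set.univ from Set.eq_univ_iff_forall.1 hK R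
  have hsmul : ∀ c : ℝ, 0 ≤ c → ∀ x ∈ K, c • x ∈ K := by
    rintro c hc _ ⟨S, Z, Y, hS, hZ, rfl⟩
    exact ⟨c • S, c • Z, c • Y, hS.smul hc, hZ.smul hc, by simp [smul_add]⟩
  have hadd : ∀ x ∈ K, ∀ y ∈ K, x + y ∈ K := by
    rintro _ ⟨S, Z, Y, hS, hZ, rfl⟩ _ ⟨S', Z', Y', hS', hZ', rfl⟩
    exact ⟨S + S', Z + Z', Y + Y', hS.add hS', hZ.add hZ', by simp only [Matrix.mul_add]; abel⟩
  refine Convex.eq_univ_of_polar_trivial (K := K) ?_ ?_ (fun c hc => hsmul c hc.le) ?_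
  · intro x hx y hy a b ha hb _
    exact hadd _ (hsmul a ha x hx) _ (hsmul b hb y hy)
  · exact ⟨0, 0, 0, .zero, .zero, by simp⟩
  intro f hf
  let b : (Fin n → ℝ) →ₗ[ℝ] (Fin n → ℝ) →ₗ[ℝ] ℝ :=
    LinearMap.mk₂ ℝ (fun x y => f (vecMulVec x y))
      (fun x x' y => by simp [add_vecMulVec]) (fun c x y => by simp [smul_vecMulVec])
      (fun x y y' => by simp [vecMulVec_add]) (fun c x y => by simp [vecMulVec_smul])
  have hpsd : ∀ x : Fin n → ℝ, (vecMulVec x x).PosSemidef := fun x => by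
    simpa using posSemidef_vecMulVec_self_star x
  have hb1 : ∀ x, b x x ≤ 0 := fun x =>
    hf _ ⟨0, vecMulVec x x, 0, .zero, hpsd x, by simp⟩
  have hb2 : ∀ x, b (X.mulVecLin x) x ≤ 0 := fun x =>
    hf _ ⟨vecMulVec x x, 0, 0, hpsd x, .zero, by simp [mul_vecMulVec]⟩
  have hb3 : ∀ u y, b (G *ᵥ u) y = 0 := by
    intro u y
    have h1 : f (vecMulVec (G *ᵥ u) y) ≤ 0 :=
      hf _ ⟨0, 0, vecMulVec u y, .zero, .zero, by simp [mul_vecMulVec]⟩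
    have h2 : f (-vecMulVec (G *ᵥ u) y) ≤ 0 :=
      hf _ ⟨0, 0, -vecMulVec u y, .zero, .zero, by simp [mul_vecMulVec]⟩
    rw [map_neg] at h2
    exact le_antisymm h1 (neg_nonpos.1 h2)
  have hpow : ∀ k : ℕ, ∀ x, (X.mulVecLin ^ k) x = X ^ k *ᵥ x := by
    intro k x
    rw [← Matrix.toLin'_apply', ← Matrix.toLin'_pow, Matrix.toLin'_apply]
  have hb : ∀ x y, b x y = 0 := by
    intro x y
    have hrep : ∀ x, b x y = (fun i => b (Pi.single i 1) y) ⬝ᵥ x := by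
      intro x
      conv_lhs => rw [pi_eq_sum_univ' x]
      simp only [map_sum, map_smul, LinearMap.sum_apply, LinearMap.smul_apply, dotProduct,
        smul_eq_mul, mul_comm]
    have hzero : (fun i => b (Pi.single i 1) y) = 0 := h _ fun k => by
      ext j
      have := bilin_pow_apply_eq_zero b X.mulVecLin hb1 hb2 (hb3 (Pi.single j 1)) k y
      rw [hrep, hpow, mulVec_mulVec, dotProduct_mulVec, dotProduct_single, mul_one] at this
      exact this
    rw [hrep, hzero, zero_dotProduct]
  refine Matrix.ext_linearMap ℝ fun i j => LinearMap.ext_ring ?_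
  have := hb (Pi.single i 1) (Pi.single j 1)
  simpa [b, ← single_eq_single_vecMulVec_single] using this

theorem star_dotProduct_map_mulVec {n : ℕ} {S : Matrix (Fin n) (Fin n) ℝ} (hS : S.PosDef)
    (z : Fin n → ℂ) :
    ∃ r : ℝ, star z ⬝ᵥ (S.map Complex.ofRealHom *ᵥ z) = r ∧ 0 ≤ r ∧ (r = 0 → z = 0) := by
  set u : Fin n → ℝ := fun i => (z i).re with hu
  set v : Fin n → ℝ := fun i => (z i).im with hv
  have hsymm : v ⬝ᵥ (S *ᵥ u) = u ⬝ᵥ (S *ᵥ v) := by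
    have hST : Sᵀ = S := by simpa using hS.isHermitian.eq
    rw [dotProduct_mulVec, ← mulVec_transpose, hST, dotProduct_comm]
  have hnonneg : ∀ x : Fin n → ℝ, 0 ≤ x ⬝ᵥ (S *ᵥ x) := fun x => by
    simpa using hS.posSemidef.dotProduct_mulVec_nonneg x
  have hzero : ∀ x : Fin n → ℝ, x ⬝ᵥ (S *ᵥ x) = 0 → x = 0 := fun x hx => by
    by_contra hx0
    have := hS.dotProduct_mulVec_pos hx0
    simp [hx] at this
  refine ⟨u ⬝ᵥ (S *ᵥ u) + v ⬝ᵥ (S *ᵥ v), ?_, add_nonneg (hnonneg u) (hnonneg v), fun h => ?_⟩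
  · apply Complex.ext
    · simp [dotProduct, mulVec, hu, hv, ← Finset.sum_add_distrib]
    · rw [Complex.ofReal_im, ← sub_eq_zero.2 hsymm.symm]
      simp [dotProduct, mulVec, hu, hv, ← Finset.sum_sub_distrib, ← sub_eq_add_neg]
  · have h1 := hzero u (by linarith [hnonneg u, hnonneg v])
    have h2 := hzero v (by linarith [hnonneg u, hnonneg v])
    ext i
    exact Complex.ext (congrFun h1 i) (congrFun h2 i)

theorem mem_spectrum_iff_exists_mulVec {ι : Type*} [Fintype ι] [DecidableEq ι]
    (A : Matrix ι ι ℂ) (μ : ℂ) : μ ∈ spectrum ℂ A ↔ ∃ v ≠ 0, A *ᵥ v = μ • v := by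
  rw [spectrum.mem_iff, Matrix.isUnit_iff_isUnit_det, isUnit_iff_ne_zero, not_not,
    ← exists_mulVec_eq_zero_iff]
  simp [sub_mulVec, Algebra.algebraMap_eq_smul_one, smul_mulVec, sub_eq_zero, eq_comm]

theorem mem_spectrum_iff_exists_vecMul {ι : Type*} [Fintype ι] [DecidableEq ι]
    (A : Matrix ι ι ℂ) (μ : ℂ) : μ ∈ spectrum ℂ A ↔ ∃ v ≠ 0, v ᵥ* A = μ • v := by
  rw [spectrum.mem_iff, Matrix.isUnit_iff_isUnit_det, isUnit_iff_ne_zero, not_not,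
    ← exists_vecMul_eq_zero_iff]
  simp [vecMul_sub, Algebra.algebraMap_eq_smul_one, vecMul_smul, sub_eq_zero, eq_comm]

theorem transpose_eq_self_of_posDef {n : ℕ} {S : Matrix (Fin n) (Fin n) ℝ} (hS : S.PosDef) :
    Sᵀ = S := by
  simpa using hS.isHermitian.eq

/-- If `(-P * M⁻¹, G)` is controllable, potential shaping is possible: `P + G * F` equals
`Mhat * M⁻¹ * Shat` for some positive definite `Mhat`, `Shat`. -/
theorem IsCtrbPair.exists_potential_shaping {n m : ℕ} {M P : Matrix (Fin n) (Fin n) ℝ}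
    {G : Matrix (Fin n) (Fin m) ℝ} (hM : M.PosDef) (h : IsCtrbPair (-P * M⁻¹) G) :
    ∃ (Mhat Shat : Matrix (Fin n) (Fin n) ℝ) (F : Matrix (Fin m) (Fin n) ℝ),
      Mhat.PosDef ∧ Shat.PosDef ∧ P - Mhat * M⁻¹ * Shat = G * F := by
  obtain ⟨S, Z, Y, hS, hZ, hR⟩ := h.exists_posSemidef_decomposition (-(-P * M⁻¹ + 1))
  have hS1 : (1 + S).PosDef := PosDef.one.add_posSemidef hS
  have hZ1 : (1 + Z).PosDef := PosDef.one.add_posSemidef hZ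
  have hMdet : IsUnit M.det := (isUnit_iff_isUnit_det M).1 hM.isUnit
  have hSdet : IsUnit (1 + S).det := (isUnit_iff_isUnit_det _).1 hS1.isUnit
  have hT : ((1 + S)⁻¹ * M)ᴴ = M * (1 + S)⁻¹ := by
    rw [conjTranspose_mul, hM.isHermitian.eq, hS1.inv.isHermitian.eq]
  have hinj : Function.Injective ((1 + S)⁻¹ * M).mulVec :=
    mulVec_injective_of_isUnit (hS1.inv.isUnit.mul hM.isUnit)
  refine ⟨1 + S, M * (1 + S)⁻¹ * (1 + Z) * ((1 + S)⁻¹ * M), Y * ((1 + S)⁻¹ * M), hS1,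
    hT ▸ hZ1.conjTranspose_mul_mul_same hinj, ?_⟩
  have hN : (1 + S) * M⁻¹ * (M * (1 + S)⁻¹ * (1 + Z) * ((1 + S)⁻¹ * M)) =
      (1 + Z) * ((1 + S)⁻¹ * M) := by
    calc _ = (1 + S) * (M⁻¹ * M) * (1 + S)⁻¹ * (1 + Z) * ((1 + S)⁻¹ * M) := by
          simp only [Matrix.mul_assoc]
      _ = _ := by rw [nonsing_inv_mul _ hMdet, Matrix.mul_one, mul_nonsing_inv _ hSdet,
          Matrix.one_mul]
  have hP : P = P * M⁻¹ * (1 + S) * ((1 + S)⁻¹ * M) := by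
    calc P = P * (M⁻¹ * ((1 + S) * (1 + S)⁻¹) * M) := by
          rw [mul_nonsing_inv _ hSdet, Matrix.mul_one, nonsing_inv_mul _ hMdet, Matrix.mul_one]
      _ = _ := by simp only [Matrix.mul_assoc]
  have hZeq : P * M⁻¹ * (1 + S) - (1 + Z) = G * Y := by
    simp only [Matrix.neg_mul] at hR
    have : G * Y = -(-(P * M⁻¹) + 1) - (-(P * M⁻¹ * S) + Z) := by rw [hR]; abel
    rw [this, Matrix.mul_add, Matrix.mul_one]
    abel
  rw [hN, ← Matrix.mul_assoc G, ← hZeq, Matrix.sub_mul, ← hP]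

theorem map_inv_ofReal {n : ℕ} (M : Matrix (Fin n) (Fin n) ℝ) (hM : M.PosDef) :
    M.map Complex.ofRealHom * M⁻¹.map Complex.ofRealHom = 1 ∧
      M⁻¹.map Complex.ofRealHom * M.map Complex.ofRealHom = 1 := by
  have hMdet : IsUnit M.det := (isUnit_iff_isUnit_det M).1 hM.isUnit
  rw [← Matrix.map_mul, ← Matrix.map_mul, mul_nonsing_inv _ hMdet, nonsing_inv_mul _ hMdet]
  simp

theorem map_vecMul_eq_mulVec {n : ℕ} {S : Matrix (Fin n) (Fin n) ℝ} (hS : S.PosDef)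
    (z : Fin n → ℂ) : z ᵥ* S.map Complex.ofRealHom = S.map Complex.ofRealHom *ᵥ z := by
  rw [← mulVec_transpose]
  congr 1
  exact congrArg (map · Complex.ofRealHom) (transpose_eq_self_of_posDef hS)

theorem star_map_mulVec {n : ℕ} {S : Matrix (Fin n) (Fin n) ℝ} (hS : S.PosDef)
    (z : Fin n → ℂ) : star (S.map Complex.ofRealHom *ᵥ z) = star z ᵥ* S.map Complex.ofRealHom := by
  rw [star_mulVec]
  congr 1
  ext i j
  simpa using congrFun (congrFun (transpose_eq_self_of_posDef hS) i) j

/-- The closed-loop matrix with injected damping is Hurwitz when `(-P * M⁻¹, G)` is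
controllable. -/
theorem IsCtrbPair.closedLoop_re_neg {n m : ℕ} {M P Mhat Shat : Matrix (Fin n) (Fin n) ℝ}
    {G : Matrix (Fin n) (Fin m) ℝ} {Kv : Matrix (Fin m) (Fin m) ℝ} {F : Matrix (Fin m) (Fin n) ℝ}
    (hM : M.PosDef) (h : IsCtrbPair (-P * M⁻¹) G) (hMh : Mhat.PosDef) (hSh : Shat.PosDef)
    (hKv : Kv.PosDef) (hF : P - Mhat * M⁻¹ * Shat = G * F) {μ : ℂ}
    (hμ : μ ∈ spectrum ℂ ((fromBlocks 0 M⁻¹ (-(Mhat * M⁻¹ * Shat))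
      (-(G * Kv * Gᵀ * Mhat⁻¹))).map Complex.ofRealHom)) : μ.re < 0 := by
  by_contra! hre
  obtain ⟨w, hw0, hw⟩ := (mem_spectrum_iff_exists_mulVec _ _).1 hμ
  obtain ⟨x, y, rfl⟩ : ∃ x y, w = Sum.elim x y :=
    ⟨w ∘ Sum.inl, w ∘ Sum.inr, (Sum.elim_comp_inl_inr w).symm⟩
  rw [isCtrbPair_iff_hautus] at h
  have hPN : P = Mhat * M⁻¹ * Shat + G * F := by rw [← hF]; abel
  have hGT : Gᵀ.map Complex.ofRealHom = (G.map Complex.ofRealHom)ᵀ := rfl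
  have hneg : ∀ {k l : ℕ} (B : Matrix (Fin k) (Fin l) ℝ),
      (-B).map Complex.ofRealHom = -(B.map Complex.ofRealHom) := fun B => by ext; simp
  rw [hPN, Matrix.neg_mul, hneg, Matrix.map_mul, Matrix.map_add _ (map_add Complex.ofRealHom)] at h
  simp only [fromBlocks_map, hneg, Matrix.map_mul, hGT] at hw h
  obtain ⟨hM1, hM2⟩ := map_inv_ofReal M hM
  obtain ⟨hh1, hh2⟩ := map_inv_ofReal Mhat hMh
  have hLv := map_vecMul_eq_mulVec hM.inv
  have hMhv := map_vecMul_eq_mulVec hMh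
  have hShv := map_vecMul_eq_mulVec hSh
  have hLs := star_map_mulVec hM.inv
  have hMhs := star_map_mulVec hMh
  have hMhq := star_dotProduct_map_mulVec hMh
  have hShq := star_dotProduct_map_mulVec hSh
  have hKq := star_dotProduct_map_mulVec hKv
  have hGs : ∀ z, star ((G.map Complex.ofRealHom)ᵀ *ᵥ z) = star z ᵥ* G.map Complex.ofRealHom := by
    intro z
    rw [star_mulVec]
    congr 1
    ext i j
    simp
  generalize M⁻¹.map Complex.ofRealHom = L at *
  generalize M.map Complex.ofRealHom = M' at *
  generalize Mhat⁻¹.map Complex.ofRealHom = Hi at *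
  generalize Mhat.map Complex.ofRealHom = H at *
  generalize Shat.map Complex.ofRealHom = S at *
  generalize Kv.map Complex.ofRealHom = K at *
  generalize G.map Complex.ofRealHom = G' at *
  generalize F.map Complex.ofRealHom = F' at *
  have e1 : L *ᵥ y = μ • x := by
    have := congrArg (· ∘ Sum.inl) hw
    simpa [fromBlocks_mulVec, Function.comp_def, Pi.smul_def, funext_iff] using this
  have e2 : -(H *ᵥ (L *ᵥ (S *ᵥ x))) - G' *ᵥ (K *ᵥ (G'ᵀ *ᵥ (Hi *ᵥ y))) = μ • y := by
    have := congrArg (· ∘ Sum.inr) hw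
    simpa [fromBlocks_mulVec, Function.comp_def, Pi.smul_def, funext_iff, neg_mulVec, mulVec_mulVec,
      Matrix.mul_assoc, sub_eq_add_neg] using this
  obtain ⟨z, rfl⟩ : ∃ z, y = H *ᵥ z := ⟨Hi *ᵥ y, by rw [mulVec_mulVec, hh1, one_mulVec]⟩
  have hz : Hi *ᵥ (H *ᵥ z) = z := by rw [mulVec_mulVec, hh2, one_mulVec]
  rw [hz] at e2
  obtain ⟨a, ha, ha0, hax⟩ := hShq x
  obtain ⟨b, hb, hb0, hbz⟩ := hMhq z
  obtain ⟨c, hc, hc0, hcz⟩ := hKq (G'ᵀ *ᵥ z)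
  have energy : -(star μ * a) - c = μ * b := by
    have := congrArg (star z ⬝ᵥ ·) e2
    simp only [dotProduct_sub, dotProduct_neg, dotProduct_smul, smul_eq_mul, hb] at this
    rw [dotProduct_mulVec, ← hMhs, dotProduct_mulVec, ← hLs, e1, star_smul, smul_dotProduct, ha,
      dotProduct_mulVec _ G', ← hGs, hc, smul_eq_mul] at this
    exact this
  have hre' := congrArg Complex.re energy
  simp at hre'
  have hG0 : G'ᵀ *ᵥ z = 0 := hcz (by nlinarith [mul_nonneg hre ha0, mul_nonneg hre hb0])
  have e3 : L *ᵥ (S *ᵥ x) = -(μ • z) := by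
    have := congrArg (Hi *ᵥ ·) e2
    simp only [hG0, mulVec_zero, sub_zero, mulVec_neg, mulVec_smul, hz] at this
    rw [mulVec_mulVec, hh2, one_mulVec] at this
    rw [← this, neg_neg]
  have hzG : z ᵥ* G' = 0 := by rwa [mulVec_transpose] at hG0
  have hz0 : z = 0 := by
    refine h (μ ^ 2) z ?_ hzG
    rw [vecMul_neg, ← vecMul_vecMul, vecMul_add, ← vecMul_vecMul, ← vecMul_vecMul,
      ← vecMul_vecMul, hzG, zero_vecMul, add_zero, hMhv, hLv (H *ᵥ z), e1,
      smul_vecMul, smul_vecMul, hShv, hLv (S *ᵥ x), e3, smul_neg, neg_neg, smul_smul, pow_two]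
  subst hz0
  have hx0 : x = 0 := by
    refine hax ?_
    have hSx : S *ᵥ x = 0 := by
      have := congrArg (M' *ᵥ ·) e3
      rw [mulVec_mulVec, hM1] at this
      simpa using this
    rw [hSx, dotProduct_zero] at ha
    exact_mod_cast ha.symm
  exact hw0 (by ext (i | i) <;> simp [hx0])

/-- If the closed-loop matrix is Hurwitz, then `(-P * M⁻¹, G)` is controllable. -/
theorem isCtrbPair_of_closedLoop_re_neg {n m : ℕ} {M P N : Matrix (Fin n) (Fin n) ℝ}
    {G : Matrix (Fin n) (Fin m) ℝ} {D F : Matrix (Fin m) (Fin n) ℝ}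
    (hM : M.PosDef) (hF : P - N = G * F)
    (hμ : ∀ μ ∈ spectrum ℂ ((fromBlocks 0 M⁻¹ (-N) (-(G * D))).map Complex.ofRealHom),
      μ.re < 0) : IsCtrbPair (-P * M⁻¹) G := by
  rw [isCtrbPair_iff_hautus]
  intro ν z hX hG
  by_contra hz0
  obtain ⟨μ, hμν, hre⟩ : ∃ μ : ℂ, μ ^ 2 = ν ∧ 0 ≤ μ.re := by
    obtain ⟨μ, hμ⟩ := IsAlgClosed.exists_pow_nat_eq ν (n := 2) (by norm_num)
    rcases le_total 0 μ.re with h0 | h0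
    · exact ⟨μ, hμ, h0⟩
    · exact ⟨-μ, by rw [neg_sq, hμ], by simpa using h0⟩
  refine (hμ μ ?_).not_ge hre
  rw [mem_spectrum_iff_exists_vecMul]
  have hneg : ∀ {k l : ℕ} (B : Matrix (Fin k) (Fin l) ℝ),
      (-B).map Complex.ofRealHom = -(B.map Complex.ofRealHom) := fun B => by ext; simp
  have hNP : N = P + G * -F := by rw [Matrix.mul_neg, ← hF]; abel
  obtain ⟨hM1, hM2⟩ := map_inv_ofReal M hM
  rw [hNP, fromBlocks_map, hneg, hneg, Matrix.map_add _ (map_add Complex.ofRealHom)]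
  simp only [Matrix.map_mul, hneg] at hX ⊢
  refine ⟨Sum.elim (μ • (z ᵥ* M.map Complex.ofRealHom)) z, fun h0 => hz0 ?_, ?_⟩
  · ext i
    exact congrFun h0 (Sum.inr i)
  · have hP : z ᵥ* P.map Complex.ofRealHom = -(ν • (z ᵥ* M.map Complex.ofRealHom)) := by
      have := congrArg (· ᵥ* M.map Complex.ofRealHom) hX
      simp only [vecMul_vecMul, Matrix.mul_assoc, hM2, Matrix.mul_one, smul_vecMul,
        vecMul_neg] at this
      rw [← this, neg_neg]
    have hzero : (0 : Matrix (Fin n) (Fin n) ℝ).map Complex.ofRealHom = 0 := by ext; simp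
    rw [vecMul_fromBlocks, Sum.elim_comp_inl, Sum.elim_comp_inr, hzero, vecMul_zero, zero_add,
      vecMul_neg, vecMul_add, vecMul_neg, smul_vecMul, ← vecMul_vecMul, ← vecMul_vecMul, hG,
      zero_vecMul, zero_vecMul, add_zero, neg_zero, add_zero, hP, neg_neg, vecMul_vecMul, hM1,
      vecMul_one, ← hμν, pow_two, ← smul_smul]
    ext (i | i) <;> simp

/-- Linear IDA-PBC: for the linear controlled Hamiltonian system
`q̇ = M⁻¹p, ṗ = −Pq + Gu` with state matrix `A = [[0, M⁻¹],[−P, 0]]` and input matrix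
`B = [[0],[G]]`, the pair `(A,B)` is controllable iff there exist constant symmetric
positive definite matrices `M̂`, `Ŝ` and `Kᵥ` satisfying the potential matching
condition `G^⊥(P − M̂M⁻¹Ŝ) = 0` such that the closed-loop state matrix
`A_cl = [[0, M⁻¹],[−M̂M⁻¹Ŝ, −GKᵥGᵀM̂⁻¹]]` has all its complex eigenvalues in the open
left half plane (i.e. the closed loop is exponentially stable). -/
theorem stmt_14 (n m : ℕ) (hmn : m ≤ n)
    (M : Matrix (Fin n) (Fin n) ℝ) (hMpos : M.PosDef) (hMsym : M.IsSymm)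
    (P : Matrix (Fin n) (Fin n) ℝ) (hPsym : P.IsSymm)
    (G : Matrix (Fin n) (Fin m) ℝ) (hG : G.rank = m)
    (Gperp : Matrix (Fin (n - m)) (Fin n) ℝ) (hGperp : Gperp.rank = n - m)
    (hGperpG : Gperp * G = 0) :
    (ctrbMatrix n m (fromBlocks 0 M⁻¹ (-P) 0) (fromRows 0 G)).rank = 2 * n ↔
      ∃ (Mhat Shat : Matrix (Fin n) (Fin n) ℝ) (Kv : Matrix (Fin m) (Fin m) ℝ),
        Mhat.PosDef ∧ Mhat.IsSymm ∧ Shat.PosDef ∧ Shat.IsSymm ∧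
        Kv.PosDef ∧ Kv.IsSymm ∧
        Gperp * (P - Mhat * M⁻¹ * Shat) = 0 ∧
        ∀ μ ∈ spectrum ℂ
          ((fromBlocks 0 M⁻¹ (-(Mhat * M⁻¹ * Shat)) (-(G * Kv * Gᵀ * Mhat⁻¹))).map
            (Complex.ofReal ·)),
          μ.re < 0 := by
  rw [rank_ctrbMatrix_iff M⁻¹ (-P) G hMpos.inv.isUnit]
  constructor
  · intro h
    obtain ⟨Mhat, Shat, F, hMhat, hShat, hF⟩ := h.exists_potential_shaping hMpos
    refine ⟨Mhat, Shat, 1, hMhat, transpose_eq_self_of_posDef hMhat, hShat,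
      transpose_eq_self_of_posDef hShat, PosDef.one, transpose_one, ?_, fun μ hμ => ?_⟩
    · rw [hF, ← Matrix.mul_assoc, hGperpG, Matrix.zero_mul]
    · exact h.closedLoop_re_neg hMpos hMhat hShat PosDef.one hF hμ
  · rintro ⟨Mhat, Shat, Kv, -, -, -, -, -, -, hmatch, hμ⟩
    obtain ⟨F, hF⟩ := exists_eq_mul_of_annihilator hmn hG hGperp hGperpG hmatch
    rw [Matrix.mul_assoc G, Matrix.mul_assoc G] at hμ
    exact isCtrbPair_of_closedLoop_re_neg hMpos hF hμ
end
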